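/- Let A and B be PSD 2×2 complex matrices. Then the following are equivalent: (i) there exist λ_A ≥ 0 and λ_B ≥ 0 such that for both i = 0,1 one has ⟨ψ*ᵢ|R(A,0)|ψ*ᵢ⟩ = λ_A·|Uᵢ⟩⟩⟨⟨Uᵢ| and ⟨ψ*ᵢ|R(0,B)|ψ*ᵢ⟩ = λ_B·|Uᵢ⟩⟩⟨⟨Uᵢ|; (ii) ⟨v|A|v⟩ = 0 and ⟨u|B|u⟩ = 0. (Lemma 5 of the paper, Appendix A: the perfect retrieval condition is equivalent to an unambiguity condition.) -/

import Mathlib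

open Matrix Kronecker Complex Filter
open scoped ComplexOrder

noncomputable section

/-- Outer product `v vᴴ`. -/
def outer {ι : Type*} [Fintype ι] (v : ι → ℂ) : Matrix ι ι ℂ :=
  Matrix.vecMulVec v (star v)

/-- The conjugated memory states `ψ*₀ = (e^{-inα}, e^{inα})/√2`, `ψ*₁ = (e^{inα}, e^{-inα})/√2`. -/
def psiStar (n : ℕ) (α : ℝ) (i : Fin 2) : Fin 2 → ℂ :=
  if i = 0 then
    ((Real.sqrt 2 : ℂ))⁻¹ • ![Complex.exp (-(Complex.I * n * α)), Complex.exp (Complex.I * n * α)]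
  else
    ((Real.sqrt 2 : ℂ))⁻¹ • ![Complex.exp (Complex.I * n * α), Complex.exp (-(Complex.I * n * α))]

/-- `|U⟩⟩ = (e^{iε},0,0,e^{-iε})` in `ℂ^{Fin 2 × Fin 2}`. -/
def Uket (ε : ℝ) : Fin 2 × Fin 2 → ℂ := fun p =>
  if p = (0, 0) then Complex.exp (Complex.I * ε)
  else if p = (1, 1) then Complex.exp (-(Complex.I * ε)) else 0

/-- `|U₀⟩⟩` and `|U₁⟩⟩`. -/
def Ui (α : ℝ) (i : Fin 2) : Fin 2 × Fin 2 → ℂ :=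
  if i = 0 then Uket α else Uket (-α)

/-- Partial sandwich `⟨w|R|w⟩` over the first (memory) factor `H₀`. -/
def sand (w : Fin 2 → ℂ)
    (R : Matrix (Fin 2 × Fin 2 × Fin 2) (Fin 2 × Fin 2 × Fin 2) ℂ) :
    Matrix (Fin 2 × Fin 2) (Fin 2 × Fin 2) ℂ :=
  Matrix.of fun p q => ∑ a : Fin 2, ∑ a' : Fin 2,
    (starRingEnd ℂ) (w a) * R (a, p.1, p.2) (a', q.1, q.2) * w a'

/-- The vector `u = (cₙ·c, sₙ·s)`. -/
def uvec (n : ℕ) (α : ℝ) : Fin 2 → ℂ :=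
  ![((Real.cos (n * α) * Real.cos α : ℝ) : ℂ), ((Real.sin (n * α) * Real.sin α : ℝ) : ℂ)]

/-- The vector `v = (cₙ·s, -sₙ·c)`. -/
def vvec (n : ℕ) (α : ℝ) : Fin 2 → ℂ :=
  ![((Real.cos (n * α) * Real.sin α : ℝ) : ℂ), ((-(Real.sin (n * α) * Real.cos α) : ℝ) : ℂ)]

/-- `⟨w|A|w⟩ = star w ⬝ᵥ A.mulVec w`. -/
def brk (w : Fin 2 → ℂ) (A : Matrix (Fin 2) (Fin 2) ℂ) : ℂ :=
  star w ⬝ᵥ A.mulVec w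

/-- Tensor product of a vector in `ℂ²` with a vector in `ℂ^{Fin 2 × Fin 2}`. -/
def tv (v : Fin 2 → ℂ) (w : Fin 2 × Fin 2 → ℂ) : Fin 2 × Fin 2 × Fin 2 → ℂ :=
  fun p => v p.1 * w p.2

/-- `|+⟩ = (1,1)/√2`. -/
def plusV : Fin 2 → ℂ := ((Real.sqrt 2 : ℂ))⁻¹ • ![1, 1]

/-- `|−⟩ = (1,−1)/√2`. -/
def minusV : Fin 2 → ℂ := ((Real.sqrt 2 : ℂ))⁻¹ • ![1, -1]

/-- `|I⟩⟩ = (1,0,0,1)`. -/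
def Iket : Fin 2 × Fin 2 → ℂ := fun p =>
  if p = (0, 0) then 1 else if p = (1, 1) then 1 else 0

/-- `|σz⟩⟩ = (1,0,0,−1)`. -/
def Zket : Fin 2 × Fin 2 → ℂ := fun p =>
  if p = (0, 0) then 1 else if p = (1, 1) then -1 else 0

/-- `e₁ = |+⟩⊗|I⟩⟩`, `e₂ = |−⟩⊗|σz⟩⟩`. -/
def eV (i : Fin 2) : Fin 2 × Fin 2 × Fin 2 → ℂ :=
  if i = 0 then tv plusV Iket else tv minusV Zket

/-- `e₁′ = |+⟩⊗|σz⟩⟩`, `e₂′ = |−⟩⊗|I⟩⟩`. -/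
def eV' (i : Fin 2) : Fin 2 × Fin 2 × Fin 2 → ℂ :=
  if i = 0 then tv plusV Zket else tv minusV Iket

/-- The block operator `R(A,B) = ∑ᵢⱼ Aᵢⱼ eᵢeⱼᴴ + ∑ᵢⱼ Bᵢⱼ eᵢ′(eⱼ′)ᴴ`. -/
def Rop (A B : Matrix (Fin 2) (Fin 2) ℂ) :
    Matrix (Fin 2 × Fin 2 × Fin 2) (Fin 2 × Fin 2 × Fin 2) ℂ :=
  (∑ i : Fin 2, ∑ j : Fin 2, A i j • Matrix.vecMulVec (eV i) (star (eV j)))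
  + (∑ i : Fin 2, ∑ j : Fin 2, B i j • Matrix.vecMulVec (eV' i) (star (eV' j)))

/-- The matrix with columns `x` and `y`. -/
def cols {ι : Type*} (x y : ι → ℂ) : Matrix ι (Fin 2) ℂ :=
  Matrix.of fun p i => ![x p, y p] i

/-- The sign distinguishing the two unitaries `U₀` and `U₁`. -/
def phaseSign (i : Fin 2) : ℂ := if i = 0 then 1 else -1

/-- Real two-dimensional vectors, viewed in `ℂ²`. -/
def realVec (a b : ℝ) : Fin 2 → ℂ := ![(a : ℂ), (b : ℂ)]

lemma phaseSign_sq (i : Fin 2) : phaseSign i ^ 2 = 1 := by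
  fin_cases i <;> simp [phaseSign]

lemma star_phaseSign (i : Fin 2) : (starRingEnd ℂ) (phaseSign i) = phaseSign i := by
  fin_cases i <;> simp [phaseSign]

lemma sand_add (w : Fin 2 → ℂ) (R S : Matrix (Fin 2 × Fin 2 × Fin 2) (Fin 2 × Fin 2 × Fin 2) ℂ) :
    sand w (R + S) = sand w R + sand w S := by
  ext p q
  simp only [sand, Matrix.of_apply, Matrix.add_apply, Fin.sum_univ_two]
  ring

lemma sand_smul (w : Fin 2 → ℂ) (z : ℂ)
    (R : Matrix (Fin 2 × Fin 2 × Fin 2) (Fin 2 × Fin 2 × Fin 2) ℂ) :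
    sand w (z • R) = z • sand w R := by
  ext p q
  simp only [sand, Matrix.of_apply, Matrix.smul_apply, Fin.sum_univ_two, smul_eq_mul]
  ring

lemma sand_vecMulVec_tv (w a b : Fin 2 → ℂ) (x y : Fin 2 × Fin 2 → ℂ) :
    sand w (Matrix.vecMulVec (tv a x) (star (tv b y))) =
      Matrix.vecMulVec ((star w ⬝ᵥ a) • x) (star ((star w ⬝ᵥ b) • y)) := by
  ext p q
  simp only [sand, tv, Matrix.of_apply, Matrix.vecMulVec_apply, Fin.sum_univ_two, dotProduct,
    Pi.smul_apply, Pi.star_apply, smul_eq_mul, star_mul', star_add,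
    RCLike.star_def, RingHomCompTriple.comp_apply, RingHom.id_apply]
  ring

lemma cols_mul_mul_conjTranspose {ι : Type*} (x y : ι → ℂ) (A : Matrix (Fin 2) (Fin 2) ℂ) :
    cols x y * A * (cols x y)ᴴ =
      A 0 0 • Matrix.vecMulVec x (star x) + A 0 1 • Matrix.vecMulVec x (star y) +
        (A 1 0 • Matrix.vecMulVec y (star x) + A 1 1 • Matrix.vecMulVec y (star y)) := by
  ext p q
  simp [cols, Matrix.mul_apply, Fin.sum_univ_two, Matrix.vecMulVec_apply]
  ring

lemma sand_Rop_left (w : Fin 2 → ℂ) (A : Matrix (Fin 2) (Fin 2) ℂ) :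
    sand w (Rop A 0) =
      cols ((star w ⬝ᵥ plusV) • Iket) ((star w ⬝ᵥ minusV) • Zket) * A *
        (cols ((star w ⬝ᵥ plusV) • Iket) ((star w ⬝ᵥ minusV) • Zket))ᴴ := by
  rw [cols_mul_mul_conjTranspose]
  simp [Rop, Fin.sum_univ_two, eV, sand_add, sand_smul, sand_vecMulVec_tv]

lemma sand_Rop_right (w : Fin 2 → ℂ) (B : Matrix (Fin 2) (Fin 2) ℂ) :
    sand w (Rop 0 B) =
      cols ((star w ⬝ᵥ plusV) • Zket) ((star w ⬝ᵥ minusV) • Iket) * B *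
        (cols ((star w ⬝ᵥ plusV) • Zket) ((star w ⬝ᵥ minusV) • Iket))ᴴ := by
  rw [cols_mul_mul_conjTranspose]
  simp [Rop, Fin.sum_univ_two, eV', sand_add, sand_smul, sand_vecMulVec_tv]

lemma inv_sqrt_two_mul_self : ((Real.sqrt 2 : ℝ) : ℂ)⁻¹ * ((Real.sqrt 2 : ℝ) : ℂ)⁻¹ = 1 / 2 := by
  rw [← mul_inv, ← Complex.ofReal_mul, Real.mul_self_sqrt (by norm_num)]
  norm_num

lemma exp_I_mul (x : ℝ) :
    Complex.exp (Complex.I * x) = (Real.cos x : ℂ) + Complex.I * (Real.sin x : ℂ) := by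
  rw [mul_comm, Complex.exp_mul_I]
  push_cast
  ring

lemma exp_neg_I_mul (x : ℝ) :
    Complex.exp (-(Complex.I * x)) = (Real.cos x : ℂ) - Complex.I * (Real.sin x : ℂ) := by
  have h := exp_I_mul (-x)
  simp only [Real.cos_neg, Real.sin_neg, Complex.ofReal_neg, mul_neg] at h
  rw [h]
  ring

lemma psiStar_eq (n : ℕ) (α : ℝ) (i : Fin 2) :
    psiStar n α i = ((Real.sqrt 2 : ℂ))⁻¹ •
      ![(Real.cos (n * α) : ℂ) - phaseSign i * Complex.I * (Real.sin (n * α) : ℂ),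
        (Real.cos (n * α) : ℂ) + phaseSign i * Complex.I * (Real.sin (n * α) : ℂ)] := by
  have h1 := exp_I_mul (n * α)
  have h2 := exp_neg_I_mul (n * α)
  rw [Complex.ofReal_mul, Complex.ofReal_natCast, ← mul_assoc] at h1 h2
  fin_cases i <;> simp [psiStar, phaseSign, h1, h2, sub_eq_add_neg]

lemma star_psiStar_dotProduct_plusV (n : ℕ) (α : ℝ) (i : Fin 2) :
    star (psiStar n α i) ⬝ᵥ plusV = (Real.cos (n * α) : ℂ) := by
  rw [psiStar_eq]
  simp only [plusV, dotProduct, Fin.sum_univ_two, Pi.star_apply, Pi.smul_apply, smul_eq_mul,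
    Matrix.cons_val_zero, Matrix.cons_val_one, RCLike.star_def, map_mul, map_add, map_sub,
    map_inv₀, Complex.conj_ofReal, Complex.conj_I, star_phaseSign]
  linear_combination (2 * (Real.cos (n * α) : ℂ)) * inv_sqrt_two_mul_self

lemma star_psiStar_dotProduct_minusV (n : ℕ) (α : ℝ) (i : Fin 2) :
    star (psiStar n α i) ⬝ᵥ minusV = (Real.sin (n * α) : ℂ) * (phaseSign i * Complex.I) := by
  rw [psiStar_eq]
  simp only [minusV, dotProduct, Fin.sum_univ_two, Pi.star_apply, Pi.smul_apply, smul_eq_mul,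
    Matrix.cons_val_zero, Matrix.cons_val_one, RCLike.star_def, map_mul, map_add, map_sub,
    map_inv₀, Complex.conj_ofReal, Complex.conj_I, star_phaseSign]
  linear_combination (2 * (Real.sin (n * α) : ℂ) * (phaseSign i * Complex.I)) *
    inv_sqrt_two_mul_self

lemma Ui_eq (α : ℝ) (i : Fin 2) :
    Ui α i = (Real.cos α : ℂ) • Iket + (Real.sin α : ℂ) • ((phaseSign i * Complex.I) • Zket) := by
  have h1 := exp_I_mul α
  have h2 := exp_neg_I_mul α
  ext ⟨a, b⟩
  fin_cases i <;> fin_cases a <;> fin_cases b <;>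
    simp [Ui, Uket, Iket, Zket, phaseSign, h1, h2] <;> ring

lemma cols_smul_smul {ι : Type*} (x y : ι → ℂ) (a b : ℝ) :
    cols ((a : ℂ) • x) ((b : ℂ) • y) = cols x y * Matrix.diagonal (realVec a b) := by
  ext p i
  fin_cases i <;> simp [cols, realVec, mul_comm]

lemma outer_linear_combination {ι : Type*} [Fintype ι] (x y : ι → ℂ) (a b : ℝ) :
    outer ((a : ℂ) • x + (b : ℂ) • y) =
      cols x y * outer (realVec a b) * (cols x y)ᴴ := by
  rw [cols_mul_mul_conjTranspose]
  ext p q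
  simp [outer, realVec, Matrix.vecMulVec_apply]
  ring

/-- Congruence by a matrix with a left inverse is injective. -/
lemma mul_mul_conjTranspose_inj {ι κ : Type*} [Fintype ι] [Fintype κ] [DecidableEq κ]
    {K : Matrix ι κ ℂ} {L : Matrix κ ι ℂ} (h : L * K = 1) {M N : Matrix κ κ ℂ} :
    K * M * Kᴴ = K * N * Kᴴ ↔ M = N := by
  refine ⟨fun e => ?_, fun e => by rw [e]⟩
  have key (X : Matrix κ κ ℂ) : L * (K * X * Kᴴ) * Lᴴ = X := by
    have h' : Kᴴ * Lᴴ = 1 := by rw [← Matrix.conjTranspose_mul, h, Matrix.conjTranspose_one]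
    rw [Matrix.mul_assoc L, Matrix.mul_assoc (K * X), h', Matrix.mul_one, ← Matrix.mul_assoc, h,
      Matrix.one_mul]
  rw [← key M, e, key]

lemma cols_leftInverse {x y : Fin 2 × Fin 2 → ℂ} (hx : star x ⬝ᵥ x = 2) (hy : star y ⬝ᵥ y = 2)
    (hxy : star x ⬝ᵥ y = 0) : ((1 / 2 : ℂ) • (cols x y)ᴴ) * cols x y = 1 := by
  have hyx : star y ⬝ᵥ x = 0 := by
    rw [Matrix.star_dotProduct, hxy, star_zero]
  simp only [dotProduct, Pi.star_apply, RCLike.star_def] at hx hy hxy hyx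
  ext i j
  fin_cases i <;> fin_cases j <;>
    simp [cols, Matrix.mul_apply, mul_assoc, ← Finset.mul_sum, hx, hy, hxy, hyx]

lemma outer_realVec_apply (a b : ℝ) (i j : Fin 2) :
    outer (realVec a b) i j = realVec a b i * realVec a b j := by
  fin_cases j <;> simp [outer, realVec, Matrix.vecMulVec_apply]

lemma diagonal_realVec_congr_apply (a b : ℝ) (A : Matrix (Fin 2) (Fin 2) ℂ) (i j : Fin 2) :
    (Matrix.diagonal (realVec a b) * A * (Matrix.diagonal (realVec a b))ᴴ) i j =
      realVec a b i * A i j * realVec a b j := by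
  rw [Matrix.diagonal_conjTranspose, Matrix.mul_diagonal, Matrix.diagonal_mul]
  fin_cases j <;> simp [realVec]

/-- A positive semidefinite `A` is killed by the vector `(d₀w₁, -d₁w₀)` exactly when the congruence
of `A` by `diag d` is a nonnegative multiple of the projection onto the unit vector `w`. -/
lemma brk_eq_zero_iff {A : Matrix (Fin 2) (Fin 2) ℂ} (hA : A.PosSemidef) (d₀ d₁ w₀ w₁ : ℝ)
    (hw : w₀ ^ 2 + w₁ ^ 2 = 1) :
    brk (realVec (d₀ * w₁) (-(d₁ * w₀))) A = 0 ↔ ∃ lam : ℝ, 0 ≤ lam ∧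
      Matrix.diagonal (realVec d₀ d₁) * A * (Matrix.diagonal (realVec d₀ d₁))ᴴ =
        (lam : ℂ) • outer (realVec w₀ w₁) := by
  have hw' : (w₀ : ℂ) ^ 2 + (w₁ : ℂ) ^ 2 = 1 := by exact_mod_cast hw
  constructor
  · intro h
    have hv := (hA.dotProduct_mulVec_zero_iff _).1 h
    have e0 := congrFun hv 0
    have e1 := congrFun hv 1
    simp only [realVec, Matrix.mulVec, dotProduct, Fin.sum_univ_two, Matrix.cons_val_zero,
      Matrix.cons_val_one, Pi.zero_apply, Complex.ofReal_mul, Complex.ofReal_neg] at e0 e1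
    have c0 := congrArg (starRingEnd ℂ) e0
    have c1 := congrArg (starRingEnd ℂ) e1
    have hh (i j : Fin 2) : (starRingEnd ℂ) (A i j) = A j i := hA.isHermitian.apply j i
    simp only [map_add, map_mul, map_neg, Complex.conj_ofReal, hh, map_zero] at c0 c1
    have r0 : A 0 0 = ((A 0 0).re : ℂ) := (Complex.conj_eq_iff_re.1 (hh 0 0)).symm
    have r1 : A 1 1 = ((A 1 1).re : ℂ) := (Complex.conj_eq_iff_re.1 (hh 1 1)).symm
    have p0 : 0 ≤ (A 0 0).re := (Complex.le_def.1 (hA.diag_nonneg (i := 0))).1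
    have p1 : 0 ≤ (A 1 1).re := (Complex.le_def.1 (hA.diag_nonneg (i := 1))).1
    refine ⟨d₀ ^ 2 * (A 0 0).re + d₁ ^ 2 * (A 1 1).re, by positivity, ?_⟩
    push_cast
    rw [← r0, ← r1]
    ext i j
    rw [diagonal_realVec_congr_apply, Matrix.smul_apply, outer_realVec_apply, smul_eq_mul]
    fin_cases i <;> fin_cases j <;>
      simp only [realVec, Fin.zero_eta, Fin.mk_one, Matrix.cons_val_zero, Matrix.cons_val_one]
    · linear_combination (-(d₀ ^ 2 * A 0 0) : ℂ) * hw' + (w₁ * d₀ : ℂ) * e0 + (w₀ * d₁ : ℂ) * c1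
    · linear_combination (-(d₀ * d₁ * A 0 1) : ℂ) * hw' - (w₀ * d₀ : ℂ) * e0 +
        (w₁ * d₁ : ℂ) * c1
    · linear_combination (-(d₀ * d₁ * A 1 0) : ℂ) * hw' - (w₀ * d₀ : ℂ) * c0 +
        (w₁ * d₁ : ℂ) * e1
    · linear_combination (-(d₁ ^ 2 * A 1 1) : ℂ) * hw' - (w₁ * d₀ : ℂ) * e0 - (w₀ * d₁ : ℂ) * c1
  · rintro ⟨lam, -, h⟩
    have entry (i j : Fin 2) := congrFun (congrFun h i) j
    simp only [diagonal_realVec_congr_apply, Matrix.smul_apply, outer_realVec_apply,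
      smul_eq_mul] at entry
    have h00 := entry 0 0
    have h01 := entry 0 1
    have h10 := entry 1 0
    have h11 := entry 1 1
    simp only [realVec, Matrix.cons_val_zero, Matrix.cons_val_one] at h00 h01 h10 h11
    simp [brk, realVec, Matrix.mulVec, dotProduct, Fin.sum_univ_two]
    linear_combination (w₁ : ℂ) ^ 2 * h00 - (w₁ : ℂ) * w₀ * h01 - (w₁ : ℂ) * w₀ * h10 +
      (w₀ : ℂ) ^ 2 * h11

lemma sandwich_eq_iff {x y : Fin 2 × Fin 2 → ℂ} (hx : star x ⬝ᵥ x = 2) (hy : star y ⬝ᵥ y = 2)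
    (hxy : star x ⬝ᵥ y = 0) (A : Matrix (Fin 2) (Fin 2) ℂ) (d₀ d₁ w₀ w₁ : ℝ) (z : ℂ) :
    cols ((d₀ : ℂ) • x) ((d₁ : ℂ) • y) * A * (cols ((d₀ : ℂ) • x) ((d₁ : ℂ) • y))ᴴ =
        z • outer ((w₀ : ℂ) • x + (w₁ : ℂ) • y) ↔
      Matrix.diagonal (realVec d₀ d₁) * A * (Matrix.diagonal (realVec d₀ d₁))ᴴ =
        z • outer (realVec w₀ w₁) := by
  rw [cols_smul_smul, outer_linear_combination, ← Matrix.smul_mul, ← Matrix.mul_smul,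
    Matrix.conjTranspose_mul, ← mul_mul_conjTranspose_inj (cols_leftInverse hx hy hxy)]
  simp only [Matrix.mul_assoc]

lemma outer_smul_of_star_mul_self {ι : Type*} [Fintype ι] {z : ℂ}
    (hz : z * (starRingEnd ℂ) z = 1) (x : ι → ℂ) : outer (z • x) = outer x := by
  ext p q
  simp only [outer, Matrix.vecMulVec_apply, Pi.smul_apply, Pi.star_apply, smul_eq_mul, star_mul',
    RCLike.star_def]
  linear_combination (x p * (starRingEnd ℂ) (x q)) * hz

lemma phase_mul_conj (i : Fin 2) :
    (phaseSign i * Complex.I) * (starRingEnd ℂ) (phaseSign i * Complex.I) = 1 := by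
  simp only [map_mul, star_phaseSign, Complex.conj_I]
  linear_combination phaseSign_sq i - phaseSign i ^ 2 * Complex.I_sq

lemma star_smul_dotProduct_smul_phase (i : Fin 2) (x : Fin 2 × Fin 2 → ℂ) :
    star ((phaseSign i * Complex.I) • x) ⬝ᵥ ((phaseSign i * Complex.I) • x) = star x ⬝ᵥ x := by
  rw [star_smul, smul_dotProduct, dotProduct_smul, smul_smul, RCLike.star_def, mul_comm,
    phase_mul_conj, one_smul]

lemma star_Iket_dotProduct_Iket : star Iket ⬝ᵥ Iket = 2 := by
  simp [dotProduct, Fintype.sum_prod_type, Iket, one_add_one_eq_two]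

lemma star_Zket_dotProduct_Zket : star Zket ⬝ᵥ Zket = 2 := by
  simp [dotProduct, Fintype.sum_prod_type, Zket, one_add_one_eq_two]

lemma star_Iket_dotProduct_Zket : star Iket ⬝ᵥ Zket = 0 := by
  simp [dotProduct, Fintype.sum_prod_type, Iket, Zket]

lemma star_Zket_dotProduct_Iket : star Zket ⬝ᵥ Iket = 0 := by
  simp [dotProduct, Fintype.sum_prod_type, Iket, Zket]

lemma sand_Rop_left_eq_iff (n : ℕ) (α : ℝ) (i : Fin 2) (A : Matrix (Fin 2) (Fin 2) ℂ) (z : ℂ) :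
    sand (psiStar n α i) (Rop A 0) = z • outer (Ui α i) ↔
      Matrix.diagonal (realVec (Real.cos (n * α)) (Real.sin (n * α))) * A *
          (Matrix.diagonal (realVec (Real.cos (n * α)) (Real.sin (n * α))))ᴴ =
        z • outer (realVec (Real.cos α) (Real.sin α)) := by
  rw [sand_Rop_left, star_psiStar_dotProduct_plusV, star_psiStar_dotProduct_minusV, mul_smul,
    Ui_eq]
  refine sandwich_eq_iff star_Iket_dotProduct_Iket ?_ ?_ A _ _ _ _ z
  · rw [star_smul_dotProduct_smul_phase, star_Zket_dotProduct_Zket]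
  · rw [dotProduct_smul, star_Iket_dotProduct_Zket, smul_zero]

lemma sand_Rop_right_eq_iff (n : ℕ) (α : ℝ) (i : Fin 2) (B : Matrix (Fin 2) (Fin 2) ℂ) (z : ℂ) :
    sand (psiStar n α i) (Rop 0 B) = z • outer (Ui α i) ↔
      Matrix.diagonal (realVec (Real.cos (n * α)) (Real.sin (n * α))) * B *
          (Matrix.diagonal (realVec (Real.cos (n * α)) (Real.sin (n * α))))ᴴ =
        z • outer (realVec (-Real.sin α) (Real.cos α)) := by
  have hU : outer (Ui α i) = outer (((-Real.sin α : ℝ) : ℂ) • Zket +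
      (Real.cos α : ℂ) • ((phaseSign i * Complex.I) • Iket)) := by
    rw [← outer_smul_of_star_mul_self (phase_mul_conj i) (Ui α i),
      Ui_eq]
    congr 1
    ext p
    simp only [Pi.smul_apply, Pi.add_apply, smul_eq_mul, Complex.ofReal_neg]
    linear_combination (Real.sin α * Zket p : ℂ) *
      (Complex.I ^ 2 * phaseSign_sq i + Complex.I_sq)
  rw [sand_Rop_right, star_psiStar_dotProduct_plusV, star_psiStar_dotProduct_minusV, mul_smul, hU]
  refine sandwich_eq_iff star_Zket_dotProduct_Zket ?_ ?_ B _ _ _ _ z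
  · rw [star_smul_dotProduct_smul_phase, star_Iket_dotProduct_Iket]
  · rw [dotProduct_smul, star_Zket_dotProduct_Iket, smul_zero]

theorem perfect_retrieval_iff_unambiguity (n : ℕ) (hn : 1 ≤ n) (α : ℝ) (hα : 0 < α)
    (hdist : 4 * n * α < Real.pi) (A B : Matrix (Fin 2) (Fin 2) ℂ)
    (hA : A.PosSemidef) (hB : B.PosSemidef) :
    (∃ lamA lamB : ℝ, 0 ≤ lamA ∧ 0 ≤ lamB ∧
      (∀ i : Fin 2,
        sand (psiStar n α i) (Rop A 0) = (lamA : ℂ) • outer (Ui α i) ∧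
        sand (psiStar n α i) (Rop 0 B) = (lamB : ℂ) • outer (Ui α i)))
    ↔ (brk (vvec n α) A = 0 ∧ brk (uvec n α) B = 0) := by
  have hv : vvec n α = realVec (Real.cos (n * α) * Real.sin α) (-(Real.sin (n * α) * Real.cos α)) :=
    rfl
  have hu : uvec n α =
      realVec (Real.cos (n * α) * Real.cos α) (-(Real.sin (n * α) * -Real.sin α)) := by
    simp [uvec, realVec]
  rw [hv, hu, brk_eq_zero_iff hA _ _ _ _ (Real.cos_sq_add_sin_sq α),
    brk_eq_zero_iff hB _ _ _ _ (by rw [neg_sq, Real.sin_sq_add_cos_sq])]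
  simp only [sand_Rop_left_eq_iff, sand_Rop_right_eq_iff, forall_const]
  constructor
  · rintro ⟨a, b, ha, hb, hAa, hBb⟩
    exact ⟨⟨a, ha, hAa⟩, ⟨b, hb, hBb⟩⟩
  · rintro ⟨⟨a, ha, hAa⟩, ⟨b, hb, hBb⟩⟩
    exact ⟨a, b, ha, hb, hAa, hBb⟩
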